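/- Let 𝒜 be of nonstandard p(·)-growth with constants a₋, b⁺ and let u be 𝒜-harmonic in ℝⁿ. Suppose there exist a constant C > 0, an exponent α < p⁻/p⁺ − n/p⁺, and an increasing unbounded sequence of radii R_k with R_k > 1 such that |u(x)| ≤ C|x|^{α} for all x ∈ B_{2R_k}∖B_{R_k} and all k. Then u is constant. -/

import Mathlib

open MeasureTheory Metric Real
open scoped ContDiff

noncomputable section

abbrev Euc (n : ℕ) := EuclideanSpace ℝ (Fin n)

/-- Measure of the unit ball in `ℝⁿ`. -/
def omegaEuc (n : ℕ) : ℝ := (volume (Metric.ball (0 : Euc n) 1)).toReal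

/-- A measurable variable exponent `p` with `p⁻ = pm` and `p⁺ = pP`,
`1 < p⁻` and `p⁺ < ∞` (encoded by the a.e. bounds). -/
structure IsVarExp {n : ℕ} (p : Euc n → ℝ) (pm pP : ℝ) : Prop where
  meas : Measurable p
  one_lt : 1 < pm
  inf_eq : essInf p (volume : Measure (Euc n)) = pm
  sup_eq : essSup p (volume : Measure (Euc n)) = pP
  ae_lb : ∀ᵐ x ∂(volume : Measure (Euc n)), pm ≤ p x
  ae_ub : ∀ᵐ x ∂(volume : Measure (Euc n)), p x ≤ pP

/-- `𝒜` is of nonstandard `p(·)`-growth with constants `am = a₋`, `bP = b⁺`. -/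
structure IsNSGrowth {n : ℕ} (p : Euc n → ℝ) (𝒜 : Euc n → ℝ → Euc n → Euc n)
    (am bP : ℝ) : Prop where
  am_pos : 0 < am
  meas : ∀ (t : ℝ) (ξ : Euc n), Measurable (fun x => 𝒜 x t ξ)
  cont : ∀ x : Euc n, Continuous (fun tξ : ℝ × Euc n => 𝒜 x tξ.1 tξ.2)
  growth : ∃ a b : Euc n → ℝ, Measurable a ∧ Measurable b ∧
      (∀ x, am ≤ a x ∧ a x ≤ b x ∧ b x ≤ bP) ∧
      (∀ x t ξ, a x * ‖ξ‖ ^ p x ≤ (inner ℝ (𝒜 x t ξ) ξ : ℝ)) ∧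
      (∀ x t ξ, ‖𝒜 x t ξ‖ ≤ b x * ‖ξ‖ ^ (p x - 1))

/-- `u` is `𝒜`-harmonic in `ℝⁿ` (C¹ functions replace `W^{1,p(·)}_loc`). -/
def IsAHarmonic {n : ℕ} (p : Euc n → ℝ) (𝒜 : Euc n → ℝ → Euc n → Euc n)
    (u : Euc n → ℝ) : Prop :=
  ContDiff ℝ 1 u ∧
  LocallyIntegrable (fun x => ‖gradient u x‖ ^ p x) (volume : Measure (Euc n)) ∧
  ∀ φ : Euc n → ℝ, ContDiff ℝ ∞ φ → HasCompactSupport φ →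
    ∫ x, (inner ℝ (𝒜 x (u x) (gradient u x)) (gradient φ x) : ℝ) = 0

/-- `u` is an `𝒜`-subsolution in `ℝⁿ`. -/
def IsASubsolution {n : ℕ} (p : Euc n → ℝ) (𝒜 : Euc n → ℝ → Euc n → Euc n)
    (u : Euc n → ℝ) : Prop :=
  ContDiff ℝ 1 u ∧
  LocallyIntegrable (fun x => ‖gradient u x‖ ^ p x) (volume : Measure (Euc n)) ∧
  ∀ φ : Euc n → ℝ, ContDiff ℝ ∞ φ → HasCompactSupport φ → (∀ x, 0 ≤ φ x) →
    ∫ x, (inner ℝ (𝒜 x (u x) (gradient u x)) (gradient φ x) : ℝ) ≤ 0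

/-- `ℬ` is an admissible right-hand side. -/
structure IsAdmissibleRHS {n : ℕ} (p : Euc n → ℝ) (ℬ : Euc n → ℝ → Euc n → ℝ) : Prop where
  meas : ∀ (t : ℝ) (ξ : Euc n), Measurable (fun x => ℬ x t ξ)
  cont : ∀ x : Euc n, Continuous (fun tξ : ℝ × Euc n => ℬ x tξ.1 tξ.2)
  bound : ∃ c : Euc n → ℝ, Measurable c ∧ (∃ cP : ℝ, ∀ x, c x ≤ cP) ∧
      ∀ x t ξ, |ℬ x t ξ| ≤ c x * (1 + ‖ξ‖ ^ (p x - 1))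

/-- `u` is `(𝒜,ℬ)`-harmonic in `ℝⁿ`. -/
def IsABHarmonic {n : ℕ} (p : Euc n → ℝ) (𝒜 : Euc n → ℝ → Euc n → Euc n)
    (ℬ : Euc n → ℝ → Euc n → ℝ) (u : Euc n → ℝ) : Prop :=
  ContDiff ℝ 1 u ∧
  LocallyIntegrable (fun x => ‖gradient u x‖ ^ p x) (volume : Measure (Euc n)) ∧
  ∀ φ : Euc n → ℝ, ContDiff ℝ ∞ φ → HasCompactSupport φ →
    ∫ x, (inner ℝ (𝒜 x (u x) (gradient u x)) (gradient φ x) : ℝ)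
      = ∫ x, ℬ x (u x) (gradient u x) * φ x

/-- `u` is a supersolution of `div 𝒜(x,u,∇u) = f(u)` in `ℝⁿ`. -/
def IsFSupersolution {n : ℕ} (p : Euc n → ℝ) (𝒜 : Euc n → ℝ → Euc n → Euc n)
    (f : ℝ → ℝ) (u : Euc n → ℝ) : Prop :=
  ContDiff ℝ 1 u ∧
  LocallyIntegrable (fun x => ‖gradient u x‖ ^ p x) (volume : Measure (Euc n)) ∧
  ∀ φ : Euc n → ℝ, ContDiff ℝ ∞ φ → HasCompactSupport φ → (∀ x, 0 ≤ φ x) →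
    ∫ x, f (u x) * φ x ≤ - ∫ x, (inner ℝ (𝒜 x (u x) (gradient u x)) (gradient φ x) : ℝ)


section WeakForm

variable {E : Type*} [NormedAddCommGroup E] [NormedSpace ℝ E] [FiniteDimensional ℝ E]
  [MeasurableSpace E] [BorelSpace E] {μ : Measure E}

open scoped Convolution in
/-- A compactly supported `C¹` function is `C¹`-close to smooth functions supported nearby. -/
theorem exists_contDiff_fderiv_approx {φ : E → ℝ} (hφ : ContDiff ℝ 1 φ)
    (hc : HasCompactSupport φ) {ε : ℝ} (hε : 0 < ε) :
    ∃ ψ : E → ℝ, ContDiff ℝ ∞ ψ ∧ Function.support ψ ⊆ cthickening 1 (tsupport φ) ∧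
      ∀ x, ‖fderiv ℝ φ x - fderiv ℝ ψ x‖ ≤ ε := by
  let μ : Measure E := Measure.addHaar
  have hcont := hφ.continuous_fderiv one_ne_zero
  have huc : UniformContinuous (fderiv ℝ φ) :=
    (hc.fderiv ℝ).uniformContinuous_of_continuous hcont
  obtain ⟨δ, hδ, hδε⟩ := Metric.uniformContinuous_iff.1 huc ε hε
  have hr : 0 < min δ 1 := lt_min hδ one_pos
  let f : ContDiffBump (0 : E) := ⟨min δ 1 / 2, min δ 1, half_pos hr, half_lt_self hr⟩
  have hint : LocallyIntegrable (f.normed μ) μ := f.continuous_normed.locallyIntegrable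
  refine ⟨f.normed μ ⋆[ContinuousLinearMap.lsmul ℝ ℝ, μ] φ, ?_, ?_, fun x => ?_⟩
  · exact f.hasCompactSupport_normed.contDiff_convolution_left _ f.contDiff_normed
      hφ.continuous.locallyIntegrable
  · refine (support_convolution_subset _).trans ?_
    rintro _ ⟨a, ha, b, hb, rfl⟩
    refine mem_cthickening_of_dist_le _ b _ _ (subset_closure hb) ?_
    rw [f.support_normed_eq, mem_ball_zero_iff] at ha
    have : ‖a‖ < 1 := ha.trans_le (min_le_right _ _)
    simpa using this.le
  · have h1 := (hc.hasFDerivAt_convolution_right (ContinuousLinearMap.lsmul ℝ ℝ) hint hφ x).fderiv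
    have h2 : (f.normed μ ⋆[(ContinuousLinearMap.lsmul ℝ ℝ).precompR E, μ] fderiv ℝ φ) x
        = (f.normed μ ⋆[ContinuousLinearMap.lsmul ℝ ℝ, μ] fderiv ℝ φ) x := by
      simp only [convolution_def]
      rfl
    rw [h1, h2, ← dist_eq_norm, dist_comm]
    refine f.dist_normed_convolution_le hcont.aestronglyMeasurable fun y hy => ?_
    exact (hδε (lt_of_lt_of_le (mem_ball.1 hy) (min_le_left _ _))).le

theorem MeasureTheory.LocallyIntegrable.integrable_clm_apply_of_hasCompactSupport
    {G : E → E} (hG : LocallyIntegrable G μ) {L : E → E →L[ℝ] ℝ} (hL : Continuous L)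
    (hc : HasCompactSupport L) : Integrable (fun x => L x (G x)) μ := by
  have hn : LocallyIntegrable (fun x => ‖G x‖) μ :=
    hG.mono hG.aestronglyMeasurable.norm (by simp)
  have h := hn.integrable_smul_left_of_hasCompactSupport hL.norm hc.norm
  refine h.mono' ?_ (Filter.Eventually.of_forall fun x => (L x).le_opNorm (G x))
  exact (isBoundedBilinearMap_apply (𝕜 := ℝ)).continuous.comp_aestronglyMeasurable₂
    hL.aestronglyMeasurable hG.aestronglyMeasurable

/-- A weak identity tested with smooth functions extends to `C¹` test functions. -/
theorem integral_fderiv_apply_eq_zero_of_contDiff_one {G : E → E} (hG : LocallyIntegrable G μ)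
    (h : ∀ φ : E → ℝ, ContDiff ℝ ∞ φ → HasCompactSupport φ →
      ∫ x, fderiv ℝ φ x (G x) ∂μ = 0)
    {φ : E → ℝ} (hφ : ContDiff ℝ 1 φ) (hc : HasCompactSupport φ) :
    ∫ x, fderiv ℝ φ x (G x) ∂μ = 0 := by
  have hK : IsCompact (cthickening 1 (tsupport φ)) := IsCompact.cthickening hc
  set K := cthickening 1 (tsupport φ) with hKdef
  have hKm : MeasurableSet K := isClosed_cthickening.measurableSet
  have key : ∀ ε > 0, |∫ x, fderiv ℝ φ x (G x) ∂μ| ≤ ε * ∫ x in K, ‖G x‖ ∂μ := by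
    intro ε hε
    obtain ⟨ψ, hψ, hsupp, hclose⟩ := exists_contDiff_fderiv_approx hφ hc hε
    have htsupp : tsupport ψ ⊆ K := closure_minimal hsupp isClosed_cthickening
    have hψc : HasCompactSupport ψ := hK.of_isClosed_subset (isClosed_tsupport _) htsupp
    have i1 := hG.integrable_clm_apply_of_hasCompactSupport
      (hφ.continuous_fderiv one_ne_zero) (hc.fderiv ℝ)
    have i2 := hG.integrable_clm_apply_of_hasCompactSupport
      (hψ.continuous_fderiv (by simp)) (hψc.fderiv ℝ)
    have e : ∫ x, fderiv ℝ φ x (G x) ∂μ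
        = ∫ x, (fderiv ℝ φ x (G x) - fderiv ℝ ψ x (G x)) ∂μ := by
      rw [integral_sub i1 i2, h ψ hψ hψc, sub_zero]
    rw [e, ← Real.norm_eq_abs, ← integral_const_mul, ← integral_indicator hKm]
    have i3 : IntegrableOn (fun x => ε * ‖G x‖) K μ :=
      ((hG.integrableOn_isCompact hK).norm).const_mul ε
    refine norm_integral_le_of_norm_le (i3.integrable_indicator hKm)
      (Filter.Eventually.of_forall fun x => ?_)
    by_cases hx : x ∈ K
    · rw [Set.indicator_of_mem hx, ← sub_apply]
      exact ((fderiv ℝ φ x - fderiv ℝ ψ x).le_opNorm _).trans (by gcongr; exact hclose x)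
    · have h1 : fderiv ℝ φ x = 0 := by
        by_contra hne
        exact hx (self_subset_cthickening _ (support_fderiv_subset ℝ hne))
      have h2 : fderiv ℝ ψ x = 0 := by
        by_contra hne
        exact hx (htsupp (support_fderiv_subset ℝ hne))
      simp [Set.indicator_of_notMem hx, h1, h2]
  have hlim : Filter.Tendsto (fun ε : ℝ => ε * ∫ x in K, ‖G x‖ ∂μ)
      (nhdsWithin 0 (Set.Ioi 0)) (nhds 0) := by
    have : Filter.Tendsto (fun ε : ℝ => ε * ∫ x in K, ‖G x‖ ∂μ) (nhds 0)
        (nhds (0 * ∫ x in K, ‖G x‖ ∂μ)) := Filter.tendsto_id.mul_const _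
    rw [zero_mul] at this
    exact this.mono_left nhdsWithin_le_nhds
  exact abs_nonpos_iff.1 (ge_of_tendsto hlim (Filter.eventually_of_mem self_mem_nhdsWithin key))

end WeakForm

/-- Cutoff functions adapted to the annuli `B_{2R} \ B_R`. -/
theorem exists_cutoff (E : Type*) [NormedAddCommGroup E] [NormedSpace ℝ E]
    [FiniteDimensional ℝ E] :
    ∃ L : ℝ, 0 ≤ L ∧ ∀ R : ℝ, 0 < R → ∃ η : E → ℝ, ContDiff ℝ 1 η ∧ HasCompactSupport η ∧
      (∀ x, 0 ≤ η x) ∧ (∀ x, η x ≤ 1) ∧ (∀ x ∈ ball (0 : E) R, η x = 1) ∧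
      (∀ x, x ∉ ball (0 : E) (2 * R) \ ball 0 R → fderiv ℝ η x = 0) ∧
      ∀ x, ‖fderiv ℝ η x‖ ≤ L / R := by
  let f : ContDiffBump (0 : E) := ⟨1, 2, one_pos, one_lt_two⟩
  have hf : ContDiff ℝ 1 f := f.contDiff
  obtain ⟨L, hL⟩ := (f.hasCompactSupport.fderiv ℝ).exists_bound_of_continuous
    (hf.continuous_fderiv one_ne_zero)
  refine ⟨L, (norm_nonneg _).trans (hL 0), fun R hR => ⟨fun x => f (R⁻¹ • x), ?_, ?_,
    fun x => f.nonneg, fun x => f.le_one, fun x hx => ?_, fun x hx => ?_, fun x => ?_⟩⟩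
  · exact hf.comp (contDiff_const_smul _)
  · exact f.hasCompactSupport.comp_smul (inv_ne_zero hR.ne')
  · refine f.one_of_mem_closedBall ?_
    rw [mem_ball_zero_iff] at hx
    rw [mem_closedBall_zero_iff, norm_smul, norm_inv, Real.norm_of_nonneg hR.le]
    exact (inv_mul_le_one₀ hR).2 hx.le
  · by_cases h2 : ‖x‖ < 2 * R
    · have h1 : ‖x‖ < R := by
        by_contra h1
        exact hx ⟨by simpa using h2, by simpa using h1⟩
      refine IsLocalMax.fderiv_eq_zero (Filter.Eventually.of_forall fun y => ?_)
      have : f (R⁻¹ • x) = 1 := by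
        refine f.one_of_mem_closedBall ?_
        rw [mem_closedBall_zero_iff, norm_smul, norm_inv, Real.norm_of_nonneg hR.le]
        exact (inv_mul_le_one₀ hR).2 h1.le
      simp only [this]
      exact f.le_one
    · refine IsLocalMin.fderiv_eq_zero (Filter.Eventually.of_forall fun y => ?_)
      have : f (R⁻¹ • x) = 0 := by
        refine f.zero_of_le_dist ?_
        rw [dist_zero_right, norm_smul, norm_inv, Real.norm_of_nonneg hR.le]
        change (2 : ℝ) ≤ _
        rw [← div_eq_inv_mul, le_div_iff₀ hR]
        exact not_lt.1 h2
      simp only [this]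
      exact f.nonneg
  · have h : fderiv ℝ (fun x => f (R⁻¹ • x)) x = R⁻¹ • fderiv ℝ f (R⁻¹ • x) :=
      fderiv_comp_smul _
    rw [h, norm_smul, norm_inv, Real.norm_of_nonneg hR.le, div_eq_inv_mul]
    gcongr
    exact hL _

/-- A Young-type inequality with constants independent of the exponent. -/
theorem mul_pow_mul_rpow_le_absorb {g η T p a : ℝ} {k : ℕ} (hg : 0 ≤ g) (hη : 0 ≤ η)
    (hη1 : η ≤ 1) (hT : 0 ≤ T) (ha : 0 < a) (hp : 1 < p) (hpk : p ≤ k + 1) :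
    T * η ^ k * g ^ (p - 1) ≤ a / 2 * (g ^ p * η ^ (k + 1)) + a / 2 * (2 * T / a) ^ p := by
  have hmul : ∀ s : ℝ, 0 ≤ s → s ^ p = s * s ^ (p - 1) := fun s hs => by
    rw [← Real.rpow_one_add' hs (by linarith)]; congr 1; ring
  rcases le_total T (a / 2 * (g * η)) with h | h
  · have h1 : T * η ^ k * g ^ (p - 1) ≤ a / 2 * (g * η) * η ^ k * g ^ (p - 1) := by gcongr
    have h2 : 0 ≤ a / 2 * (2 * T / a) ^ p := by positivity
    have h3 : a / 2 * (g * η) * η ^ k * g ^ (p - 1) = a / 2 * (g ^ p * η ^ (k + 1)) := by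
      rw [hmul g hg]; ring
    linarith
  · have h0 : g * η ≤ 2 * T / a := by
      rw [le_div_iff₀ ha]; linarith
    have h1 : η ^ k ≤ η ^ (p - 1) := by
      rw [← Real.rpow_natCast]
      exact Real.rpow_le_rpow_of_exponent_ge' hη hη1 (by linarith) (by linarith)
    have h2 : η ^ k * g ^ (p - 1) ≤ (2 * T / a) ^ (p - 1) := by
      calc η ^ k * g ^ (p - 1) ≤ η ^ (p - 1) * g ^ (p - 1) := by gcongr
        _ = (g * η) ^ (p - 1) := by rw [Real.mul_rpow hg hη, mul_comm]
        _ ≤ _ := Real.rpow_le_rpow (by positivity) h0 (by linarith)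
    have h3 : a / 2 * (2 * T / a) ^ p = T * (2 * T / a) ^ (p - 1) := by
      rw [hmul _ (by positivity)]; field_simp
    have h4 : 0 ≤ a / 2 * (g ^ p * η ^ (k + 1)) := by positivity
    rw [h3, mul_assoc]
    have := mul_le_mul_of_nonneg_left h2 hT
    linarith

/-- An odd smooth nondecreasing function vanishing exactly on `[-ε, ε]`. -/
theorem exists_contDiff_monotone_eq_zero_iff {ε : ℝ} (hε : 0 ≤ ε) :
    ∃ ψ : ℝ → ℝ, ContDiff ℝ 1 ψ ∧ Monotone ψ ∧ ∀ t, ψ t = 0 ↔ |t| ≤ ε := by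
  refine ⟨fun t => expNegInvGlue (t - ε) - expNegInvGlue (-t - ε), ?_, ?_, fun t => ?_⟩
  · have h : ContDiff ℝ 1 expNegInvGlue := expNegInvGlue.contDiff (n := 1)
    exact (h.comp (by fun_prop)).sub (h.comp (by fun_prop))
  · intro s t hst
    exact sub_le_sub (expNegInvGlue.monotone (by linarith)) (expNegInvGlue.monotone (by linarith))
  · rw [abs_le]
    constructor
    · intro h
      by_contra hcon
      rcases lt_or_ge ε t with h1 | h1
      · have := expNegInvGlue.pos_of_pos (sub_pos.2 h1)
        have h2 := expNegInvGlue.zero_of_nonpos (show -t - ε ≤ 0 by linarith)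
        simp only at h
        linarith
      · have h3 : t < -ε := by
          by_contra h3
          exact hcon ⟨not_lt.1 h3, h1⟩
        have := expNegInvGlue.pos_of_pos (show 0 < -t - ε by linarith)
        have h2 := expNegInvGlue.zero_of_nonpos (show t - ε ≤ 0 by linarith)
        simp only at h
        linarith
    · rintro ⟨h1, h2⟩
      simp only
      rw [expNegInvGlue.zero_of_nonpos (by linarith), expNegInvGlue.zero_of_nonpos (by linarith),
        sub_zero]

section Liouville

variable {n : ℕ} {p : Euc n → ℝ} {pm pP am bP : ℝ} {𝒜 : Euc n → ℝ → Euc n → Euc n}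
  {u : Euc n → ℝ}

theorem norm_gradient_eq_norm_fderiv (f : Euc n → ℝ) (x : Euc n) :
    ‖gradient f x‖ = ‖fderiv ℝ f x‖ := by
  simp [gradient]

theorem inner_gradient_eq_fderiv_apply (f : Euc n → ℝ) (x v : Euc n) :
    inner ℝ v (gradient f x) = fderiv ℝ f x v := by
  simp

theorem IsVarExp.le (hp : IsVarExp p pm pP) : pm ≤ pP := by
  obtain ⟨x, h1, h2⟩ := (hp.ae_lb.and hp.ae_ub).exists
  exact h1.trans h2

theorem IsNSGrowth.upper_pos (h𝒜 : IsNSGrowth p 𝒜 am bP) : 0 < bP := by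
  obtain ⟨a, b, -, -, hab, -, -⟩ := h𝒜.growth
  have := hab 0
  linarith [h𝒜.am_pos]

theorem IsNSGrowth.coercive (h𝒜 : IsNSGrowth p 𝒜 am bP) (u : Euc n → ℝ) (x : Euc n) :
    am * ‖fderiv ℝ u x‖ ^ p x ≤ fderiv ℝ u x (𝒜 x (u x) (gradient u x)) := by
  obtain ⟨a, b, -, -, hab, hcoer, -⟩ := h𝒜.growth
  have h := hcoer x (u x) (gradient u x)
  rw [inner_gradient_eq_fderiv_apply, norm_gradient_eq_norm_fderiv] at h
  refine le_trans ?_ h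
  gcongr
  exact (hab x).1

theorem IsNSGrowth.norm_le (h𝒜 : IsNSGrowth p 𝒜 am bP) (u : Euc n → ℝ) (x : Euc n) :
    ‖𝒜 x (u x) (gradient u x)‖ ≤ bP * ‖fderiv ℝ u x‖ ^ (p x - 1) := by
  obtain ⟨a, b, -, -, hab, -, hbd⟩ := h𝒜.growth
  have h := hbd x (u x) (gradient u x)
  rw [norm_gradient_eq_norm_fderiv] at h
  refine h.trans ?_
  gcongr
  exact (hab x).2.2

theorem IsNSGrowth.locallyIntegrable (hp : IsVarExp p pm pP) (h𝒜 : IsNSGrowth p 𝒜 am bP)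
    (hu : ContDiff ℝ 1 u) :
    LocallyIntegrable (fun x => 𝒜 x (u x) (gradient u x)) (volume : Measure (Euc n)) := by
  have hD := hu.continuous_fderiv one_ne_zero
  have hgrad : Continuous (gradient u) :=
    (InnerProductSpace.toDual ℝ (Euc n)).symm.continuous.comp hD
  have hmeas : Measurable (fun x => 𝒜 x (u x) (gradient u x)) := by
    have h := measurable_uncurry_of_continuous_of_measurable
      (u := fun (tξ : ℝ × Euc n) x => 𝒜 x tξ.1 tξ.2) h𝒜.cont (fun tξ => h𝒜.meas tξ.1 tξ.2)
    exact h.comp ((hu.continuous.measurable.prodMk hgrad.measurable).prodMk measurable_id)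
  have hbd : Continuous fun x => bP * (1 + ‖fderiv ℝ u x‖) ^ (pP - 1) := by
    refine continuous_const.mul ((continuous_const.add hD.norm).rpow_const fun x => Or.inl ?_)
    exact (add_pos_of_pos_of_nonneg one_pos (norm_nonneg _)).ne'
  refine hbd.locallyIntegrable.mono hmeas.aestronglyMeasurable ?_
  filter_upwards [hp.ae_lb, hp.ae_ub] with x h1 h2
  have hb := h𝒜.upper_pos
  refine (h𝒜.norm_le u x).trans ((le_abs_self _).trans' ?_)
  gcongr
  calc ‖fderiv ℝ u x‖ ^ (p x - 1) ≤ (1 + ‖fderiv ℝ u x‖) ^ (p x - 1) :=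
        Real.rpow_le_rpow (norm_nonneg _) (by simp) (by linarith [hp.one_lt])
    _ ≤ (1 + ‖fderiv ℝ u x‖) ^ (pP - 1) :=
        Real.rpow_le_rpow_of_exponent_le (by simp) (by linarith)

/-- Testing the equation with `ψ(u) χ`, for `ψ` of class `C¹` and `χ` a `C¹` cutoff. -/
theorem IsAHarmonic.integral_test_eq_zero (hp : IsVarExp p pm pP) (h𝒜 : IsNSGrowth p 𝒜 am bP)
    (hu : IsAHarmonic p 𝒜 u) {ψ : ℝ → ℝ} (hψ : ContDiff ℝ 1 ψ) {χ : Euc n → ℝ}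
    (hχ : ContDiff ℝ 1 χ) (hχc : HasCompactSupport χ) :
    Integrable (fun x => deriv ψ (u x) * χ x * fderiv ℝ u x (𝒜 x (u x) (gradient u x)) +
      ψ (u x) * fderiv ℝ χ x (𝒜 x (u x) (gradient u x))) ∧
    ∫ x, (deriv ψ (u x) * χ x * fderiv ℝ u x (𝒜 x (u x) (gradient u x)) +
      ψ (u x) * fderiv ℝ χ x (𝒜 x (u x) (gradient u x))) = 0 := by
  obtain ⟨hu1, -, hweak⟩ := hu
  have hG := h𝒜.locallyIntegrable hp hu1
  have hφ : ContDiff ℝ 1 (fun x => ψ (u x) * χ x) := (hψ.comp hu1).mul hχ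
  have hφc : HasCompactSupport (fun x => ψ (u x) * χ x) := hχc.mul_left
  have hder : ∀ x v, fderiv ℝ (fun x => ψ (u x) * χ x) x v =
      deriv ψ (u x) * χ x * fderiv ℝ u x v + ψ (u x) * fderiv ℝ χ x v := by
    intro x v
    have h1 := ((hψ.differentiable one_ne_zero (u x)).hasDerivAt.comp_hasFDerivAt x
      (hu1.differentiable one_ne_zero x).hasFDerivAt).mul
        (hχ.differentiable one_ne_zero x).hasFDerivAt
    have h2 := h1.fderiv
    have h3 := congrArg (fun L => L v) h2
    refine h3.trans ?_
    simp
    ring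
  have h0 := integral_fderiv_apply_eq_zero_of_contDiff_one hG (fun φ hφ hφc => by
    simpa only [inner_gradient_eq_fderiv_apply] using hweak φ hφ hφc) hφ hφc
  have hi := hG.integrable_clm_apply_of_hasCompactSupport
    (hφ.continuous_fderiv one_ne_zero) (hφc.fderiv ℝ)
  simp only [hder] at h0 hi
  exact ⟨hi, h0⟩

/-- Caccioppoli-type estimate: a bound `(κ |u| |∇η|) ^ p ≤ M`, with `∇η` supported in the ball of
radius `r`, controls the energy on any set where `η = 1`. -/
theorem IsAHarmonic.integral_rpow_le (hp : IsVarExp p pm pP) (h𝒜 : IsNSGrowth p 𝒜 am bP)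
    (hu : IsAHarmonic p 𝒜 u) {k : ℕ} (hk : pP ≤ k + 1) {η : Euc n → ℝ} (hη : ContDiff ℝ 1 η)
    (hηc : HasCompactSupport η) (hη0 : ∀ x, 0 ≤ η x) (hη1 : ∀ x, η x ≤ 1) {M r : ℝ}
    (hsupp : ∀ x ∉ ball (0 : Euc n) r, fderiv ℝ η x = 0)
    (hbound : ∀ᵐ x, (2 * ((k + 1) * bP * |u x| * ‖fderiv ℝ η x‖) / am) ^ p x ≤ M)
    {s : Set (Euc n)} (hs : MeasurableSet s) (hηs : ∀ x ∈ s, η x = 1) :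
    ∫ x in s, ‖fderiv ℝ u x‖ ^ p x ≤ M * volume.real (ball (0 : Euc n) r) := by
  have ham := h𝒜.am_pos
  have hb := h𝒜.upper_pos
  have hηk : ContDiff ℝ 1 (fun x => η x ^ (k + 1)) := hη.pow _
  have hηkc : HasCompactSupport (fun x => η x ^ (k + 1)) :=
    hηc.comp_left (g := fun t : ℝ => t ^ (k + 1)) (by simp)
  obtain ⟨hi, h0⟩ := hu.integral_test_eq_zero hp h𝒜 contDiff_id hηk hηkc
  have hE : Integrable (fun x => ‖fderiv ℝ u x‖ ^ p x * η x ^ (k + 1)) := by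
    have := hu.2.1.integrable_smul_right_of_hasCompactSupport hηk.continuous hηkc
    simpa only [norm_gradient_eq_norm_fderiv, smul_eq_mul] using this
  have hball : Integrable ((ball (0 : Euc n) r).indicator fun _ => M) :=
    (integrable_indicator_iff measurableSet_ball).2 (integrableOn_const measure_ball_lt_top.ne)
  have hpt : ∀ᵐ x, ‖fderiv ℝ u x‖ ^ p x * η x ^ (k + 1) ≤
      2 / am * (deriv id (u x) * η x ^ (k + 1) * fderiv ℝ u x (𝒜 x (u x) (gradient u x)) +
      id (u x) * fderiv ℝ (fun x => η x ^ (k + 1)) x (𝒜 x (u x) (gradient u x))) +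
      (ball (0 : Euc n) r).indicator (fun _ => M) x := by
    filter_upwards [hp.ae_lb, hp.ae_ub, hbound] with x hx1 hx2 hx3
    set g := ‖fderiv ℝ u x‖ with hg
    set T := (k + 1) * bP * |u x| * ‖fderiv ℝ η x‖ with hT
    have hTM : (2 * T / am) ^ p x ≤ (ball (0 : Euc n) r).indicator (fun _ => M) x := by
      by_cases hx : x ∈ ball (0 : Euc n) r
      · rwa [Set.indicator_of_mem hx]
      · rw [Set.indicator_of_notMem hx, hT, hsupp x hx]
        simp [Real.zero_rpow (show p x ≠ 0 by linarith [hp.one_lt])]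
    have habs := mul_pow_mul_rpow_le_absorb (g := g) (k := k) (norm_nonneg _) (hη0 x) (hη1 x)
      (show 0 ≤ T by positivity) ham (hp.one_lt.trans_le hx1) (hx2.trans hk)
    have hcoer := mul_le_mul_of_nonneg_right (h𝒜.coercive u x) (pow_nonneg (hη0 x) (k + 1))
    have hder : fderiv ℝ (fun x => η x ^ (k + 1)) x (𝒜 x (u x) (gradient u x)) =
        (k + 1) * η x ^ k * fderiv ℝ η x (𝒜 x (u x) (gradient u x)) := by
      have h := ((hη.differentiable one_ne_zero x).hasFDerivAt.pow (k + 1)).fderiv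
      have h3 := congrArg (fun L => L (𝒜 x (u x) (gradient u x))) h
      refine h3.trans ?_
      simp
    have hcross : -(u x * ((k + 1) * η x ^ k * fderiv ℝ η x (𝒜 x (u x) (gradient u x)))) ≤
        T * η x ^ k * g ^ (p x - 1) := by
      refine (neg_le_abs _).trans ?_
      rw [abs_mul, abs_mul, abs_mul, abs_of_nonneg (pow_nonneg (hη0 x) k),
        abs_of_nonneg (show (0 : ℝ) ≤ k + 1 by positivity)]
      have h1 : |fderiv ℝ η x (𝒜 x (u x) (gradient u x))| ≤
          ‖fderiv ℝ η x‖ * (bP * g ^ (p x - 1)) :=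
        ((fderiv ℝ η x).le_opNorm _).trans (by gcongr; exact h𝒜.norm_le u x)
      have h2 := pow_nonneg (hη0 x) k
      calc _ ≤ |u x| * ((k + 1) * η x ^ k * (‖fderiv ℝ η x‖ * (bP * g ^ (p x - 1)))) := by
            gcongr
        _ = _ := by rw [hT]; ring
    rw [hder, deriv_id, id]
    rw [← hg] at hcoer
    set F := fderiv ℝ u x (𝒜 x (u x) (gradient u x))
    set H := u x * ((k + 1) * η x ^ k * fderiv ℝ η x (𝒜 x (u x) (gradient u x)))
    have hmain : am / 2 * (g ^ p x * η x ^ (k + 1)) ≤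
        1 * η x ^ (k + 1) * F + H + am / 2 * (2 * T / am) ^ p x := by
      nlinarith
    have h5 := mul_le_mul_of_nonneg_left hmain (show 0 ≤ 2 / am by positivity)
    have h6 : 2 / am * (am / 2 * (g ^ p x * η x ^ (k + 1))) = g ^ p x * η x ^ (k + 1) := by
      field_simp
    have h7 : 2 / am * (1 * η x ^ (k + 1) * F + H + am / 2 * (2 * T / am) ^ p x) =
        2 / am * (1 * η x ^ (k + 1) * F + H) + (2 * T / am) ^ p x := by
      field_simp
    rw [h6, h7] at h5
    linarith
  calc ∫ x in s, ‖fderiv ℝ u x‖ ^ p x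
      = ∫ x in s, ‖fderiv ℝ u x‖ ^ p x * η x ^ (k + 1) :=
        setIntegral_congr_fun hs fun x hx => by simp [hηs x hx]
    _ ≤ ∫ x, ‖fderiv ℝ u x‖ ^ p x * η x ^ (k + 1) :=
        setIntegral_le_integral hE (Filter.Eventually.of_forall fun x => by
          have := hη0 x
          simp only [Pi.zero_apply]
          positivity)
    _ ≤ _ := integral_mono_ae hE ((hi.const_mul _).add hball) hpt
    _ = M * volume.real (ball (0 : Euc n) r) := by
        simp only [Pi.add_apply]
        rw [integral_add (hi.const_mul _) hball, integral_const_mul, h0,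
          integral_indicator_const _ measurableSet_ball]
        simp [mul_comm]

/-- A continuous function vanishing a.e. on balls of arbitrarily large radius is zero. -/
theorem Continuous.eq_zero_of_ae_eq_zero_on_balls {F : Type*} [NormedAddCommGroup F]
    {f : Euc n → F} (hf : Continuous f) {R : ℕ → ℝ}
    (hR : Filter.Tendsto R Filter.atTop Filter.atTop)
    (h : ∀ᶠ k in Filter.atTop, ∀ᵐ x, x ∈ ball (0 : Euc n) (R k) → f x = 0) (x : Euc n) :
    f x = 0 := by
  obtain ⟨K, hK⟩ := Filter.eventually_atTop.1 h
  have hall : ∀ᵐ x, ∀ k, K ≤ k → x ∈ ball (0 : Euc n) (R k) → f x = 0 := by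
    rw [ae_all_iff]
    intro k
    by_cases hk : K ≤ k
    · filter_upwards [hK k hk] with x hx _ using hx
    · exact Filter.Eventually.of_forall fun x h => absurd h hk
  have h0 : f =ᵐ[volume] fun _ => 0 := by
    filter_upwards [hall] with x hx
    obtain ⟨k, hk1, hk2⟩ := ((hR.eventually_gt_atTop ‖x‖).and (Filter.eventually_ge_atTop K)).exists
    exact hx k hk2 (by simpa using hk1)
  exact congrFun ((Continuous.ae_eq_iff_eq volume hf continuous_const).1 h0) x

/-- Maximum-principle case: decay on a sequence of annuli. -/
theorem IsAHarmonic.eq_zero_of_decay [NeZero n] (hp : IsVarExp p pm pP)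
    (h𝒜 : IsNSGrowth p 𝒜 am bP) (hu : IsAHarmonic p 𝒜 u) {C α : ℝ} (hα : α < 0) (hC : 0 < C)
    {R : ℕ → ℝ} (hR1 : ∀ k, 1 < R k) (hRtop : Filter.Tendsto R Filter.atTop Filter.atTop)
    (hgrowth : ∀ k, ∀ x ∈ ball (0 : Euc n) (2 * R k) \ ball 0 (R k), |u x| ≤ C * ‖x‖ ^ α)
    (x : Euc n) : u x = 0 := by
  have ham := h𝒜.am_pos
  suffices H : ∀ ε > 0, ∀ x, |u x| ≤ ε by
    exact abs_nonpos_iff.1 (le_of_forall_pos_le_add fun ε hε => by simpa using H ε hε x)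
  intro ε hε
  obtain ⟨ψ, hψ, hmono, hzero⟩ := exists_contDiff_monotone_eq_zero_iff hε.le
  have hlim : Filter.Tendsto (fun k => C * R k ^ α) Filter.atTop (nhds 0) := by
    have h := (tendsto_rpow_neg_atTop (neg_pos.2 hα)).comp hRtop
    simpa [Function.comp_def] using h.const_mul C
  have hsmall : ∀ᶠ k in Filter.atTop, ∀ x ∈ ball (0 : Euc n) (2 * R k) \ ball 0 (R k),
      ψ (u x) = 0 := by
    filter_upwards [hlim.eventually_lt_const hε] with k hk x hx
    have hRk : 0 < R k := one_pos.trans (hR1 k)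
    have hxR : R k ≤ ‖x‖ := by simpa using hx.2
    refine (hzero _).2 ((hgrowth k x hx).trans (le_trans ?_ hk.le))
    gcongr 1
    exact Real.rpow_le_rpow_of_nonpos hRk hxR hα.le
  obtain ⟨L, -, hcut⟩ := exists_cutoff (Euc n)
  have hcont : Continuous fun x => deriv ψ (u x) * ‖fderiv ℝ u x‖ :=
    ((hψ.continuous_deriv le_rfl).comp hu.1.continuous).mul
      (hu.1.continuous_fderiv one_ne_zero).norm
  have hder : ∀ x, deriv ψ (u x) * ‖fderiv ℝ u x‖ = 0 := by
    refine hcont.eq_zero_of_ae_eq_zero_on_balls hRtop ?_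
    filter_upwards [hsmall] with k hk
    obtain ⟨η, hη, hηc, hη0, -, hηone, hηann, -⟩ := hcut (R k) (one_pos.trans (hR1 k))
    obtain ⟨hi, h0⟩ := hu.integral_test_eq_zero hp h𝒜 hψ hη hηc
    have hcross : ∀ x, ψ (u x) * fderiv ℝ η x (𝒜 x (u x) (gradient u x)) = 0 := by
      intro x
      by_cases hx : x ∈ ball (0 : Euc n) (2 * R k) \ ball 0 (R k)
      · rw [hk x hx, zero_mul]
      · simp [hηann x hx]
    simp only [hcross, add_zero] at hi h0
    have hlow : ∀ x, deriv ψ (u x) * η x * (am * ‖fderiv ℝ u x‖ ^ p x) ≤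
        deriv ψ (u x) * η x * fderiv ℝ u x (𝒜 x (u x) (gradient u x)) := fun x =>
      mul_le_mul_of_nonneg_left (h𝒜.coercive u x)
        (mul_nonneg hmono.deriv_nonneg (hη0 x))
    have hnn : ∀ x, 0 ≤ deriv ψ (u x) * η x * (am * ‖fderiv ℝ u x‖ ^ p x) := fun x =>
      mul_nonneg (mul_nonneg hmono.deriv_nonneg (hη0 x)) (by positivity)
    have hae := (integral_eq_zero_iff_of_nonneg (fun x => (hnn x).trans (hlow x)) hi).1 h0
    filter_upwards [hae, hp.ae_lb] with x hx hpx hxR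
    have h1 := le_antisymm ((hlow x).trans hx.le) (hnn x)
    rw [hηone x hxR, mul_one] at h1
    rcases mul_eq_zero.1 h1 with h2 | h2
    · rw [h2, zero_mul]
    · rcases mul_eq_zero.1 h2 with h3 | h3
      · exact absurd h3 ham.ne'
      · rw [Real.rpow_eq_zero (norm_nonneg _) (by linarith [hp.one_lt])] at h3
        rw [h3, mul_zero]
  have hconst : ∀ x y, ψ (u x) = ψ (u y) := by
    refine is_const_of_fderiv_eq_zero (𝕜 := ℝ)
      ((hψ.comp hu.1).differentiable one_ne_zero) fun x => ?_
    have h1 := ((hψ.differentiable one_ne_zero (u x)).hasDerivAt.comp_hasFDerivAt x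
      (hu.1.differentiable one_ne_zero x).hasFDerivAt).fderiv
    refine h1.trans ?_
    rcases mul_eq_zero.1 (hder x) with h2 | h2
    · rw [h2, zero_smul]
    · rw [norm_eq_zero.1 h2, smul_zero]
  obtain ⟨k, hk⟩ := hsmall.exists
  have hRk : 0 < R k := one_pos.trans (hR1 k)
  obtain ⟨y, hy⟩ := exists_norm_eq (Euc n) hRk.le
  intro x
  refine (hzero _).1 ((hconst x y).trans (hk y ⟨?_, ?_⟩))
  · rw [mem_ball_zero_iff, hy]; linarith
  · rw [mem_ball_zero_iff, hy]; exact lt_irrefl _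

/-- Energy case: nonnegative growth exponent. -/
theorem IsAHarmonic.fderiv_eq_zero_of_growth (hp : IsVarExp p pm pP)
    (h𝒜 : IsNSGrowth p 𝒜 am bP) (hu : IsAHarmonic p 𝒜 u) {C α : ℝ} (hC : 0 < C) (hα0 : 0 ≤ α)
    (hα : α < pm / pP - (n : ℝ) / pP) {R : ℕ → ℝ} (hR1 : ∀ k, 1 < R k) (hRmono : StrictMono R)
    (hRtop : Filter.Tendsto R Filter.atTop Filter.atTop)
    (hgrowth : ∀ k, ∀ x ∈ ball (0 : Euc n) (2 * R k) \ ball 0 (R k), |u x| ≤ C * ‖x‖ ^ α)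
    (x : Euc n) : fderiv ℝ u x = 0 := by
  have ham := h𝒜.am_pos
  have hb := h𝒜.upper_pos
  have hpm := hp.one_lt
  have hpmP := hp.le
  have hpP : 0 < pP := by linarith
  have hαP : α * pP < pm - n := by
    rw [← sub_div, lt_div_iff₀ hpP] at hα
    exact hα
  have hexp : (α - 1) * pm + n < 0 := by nlinarith
  have hα1 : α ≤ 1 := by
    have : (0 : ℝ) ≤ n := Nat.cast_nonneg n
    by_contra hcon
    nlinarith
  obtain ⟨m, hm⟩ := exists_nat_ge pP
  have hm1 : pP ≤ (m : ℝ) + 1 := by linarith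
  obtain ⟨L, hL, hcut⟩ := exists_cutoff (Euc n)
  set K := max 1 (2 * ((m + 1) * bP * (C * 2 ^ α) * L) / am) with hK
  have hK1 : 1 ≤ K := le_max_left _ _
  have hestimate : ∀ k, ∫ x in ball (0 : Euc n) (R k), ‖fderiv ℝ u x‖ ^ p x ≤
      K ^ pP * 2 ^ n * volume.real (ball (0 : Euc n) 1) * R k ^ ((α - 1) * pm + n) := by
    intro k
    have hRk : 0 < R k := one_pos.trans (hR1 k)
    obtain ⟨η, hη, hηc, hη0, hη1, hηone, hηann, hηL⟩ := hcut (R k) hRk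
    have hM : ∀ᵐ x, (2 * ((m + 1) * bP * |u x| * ‖fderiv ℝ η x‖) / am) ^ p x ≤
        K ^ pP * R k ^ ((α - 1) * pm) := by
      filter_upwards [hp.ae_lb, hp.ae_ub] with x hx1 hx2
      have hbase : 2 * ((m + 1) * bP * |u x| * ‖fderiv ℝ η x‖) / am ≤ K * R k ^ (α - 1) := by
        by_cases hx : x ∈ ball (0 : Euc n) (2 * R k) \ ball 0 (R k)
        · have hxR : ‖x‖ ≤ 2 * R k := by simpa using (mem_ball.1 hx.1).le
          have hux : |u x| ≤ C * (2 ^ α * R k ^ α) := by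
            refine (hgrowth k x hx).trans ?_
            rw [← Real.mul_rpow zero_le_two hRk.le]
            gcongr
          calc 2 * ((m + 1) * bP * |u x| * ‖fderiv ℝ η x‖) / am
              ≤ 2 * ((m + 1) * bP * (C * (2 ^ α * R k ^ α)) * (L / R k)) / am := by
                gcongr
                exact hηL x
            _ = 2 * ((m + 1) * bP * (C * 2 ^ α) * L) / am * R k ^ (α - 1) := by
                rw [Real.rpow_sub_one hRk.ne']; ring
            _ ≤ K * R k ^ (α - 1) := by
                gcongr
                exact le_max_right _ _
        · rw [hηann x hx]
          simp only [norm_zero, mul_zero, zero_div]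
          positivity
      calc (2 * ((m + 1) * bP * |u x| * ‖fderiv ℝ η x‖) / am) ^ p x
          ≤ (K * R k ^ (α - 1)) ^ p x :=
            Real.rpow_le_rpow (by positivity) hbase (by linarith)
        _ = K ^ p x * R k ^ ((α - 1) * p x) := by
            rw [Real.mul_rpow (by positivity) (by positivity), ← Real.rpow_mul hRk.le]
        _ ≤ K ^ pP * R k ^ ((α - 1) * pm) := by
            gcongr ?_ * ?_
            · exact Real.rpow_le_rpow_of_exponent_le hK1 hx2
            · exact Real.rpow_le_rpow_of_exponent_le (hR1 k).le
                (mul_le_mul_of_nonpos_left hx1 (by linarith))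
    have h := hu.integral_rpow_le hp h𝒜 hm1 hη hηc hη0 hη1 (r := 2 * R k)
      (fun x hx => hηann x fun h => hx h.1) hM measurableSet_ball hηone
    refine h.trans_eq ?_
    rw [measureReal_def, Measure.addHaar_ball_of_pos _ _ (by positivity), ENNReal.toReal_mul,
      ENNReal.toReal_ofReal (by positivity), finrank_euclideanSpace_fin, ← measureReal_def,
      mul_pow, Real.rpow_add hRk, Real.rpow_natCast]
    ring
  have hlim : Filter.Tendsto (fun k => K ^ pP * 2 ^ n * volume.real (ball (0 : Euc n) 1) *
      R k ^ ((α - 1) * pm + n)) Filter.atTop (nhds 0) := by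
    have h := (tendsto_rpow_neg_atTop (neg_pos.2 hexp)).comp hRtop
    simpa only [Function.comp_def, neg_neg, mul_zero] using
      h.const_mul (K ^ pP * 2 ^ n * volume.real (ball (0 : Euc n) 1))
  have hint : ∀ r, IntegrableOn (fun x => ‖fderiv ℝ u x‖ ^ p x) (ball (0 : Euc n) r) := by
    intro r
    have h := hu.2.1.integrableOn_isCompact (isCompact_closedBall (0 : Euc n) r)
    simp only [norm_gradient_eq_norm_fderiv] at h
    exact h.mono_set ball_subset_closedBall
  have hnn : ∀ x, 0 ≤ ‖fderiv ℝ u x‖ ^ p x := fun x => by positivity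
  refine (hu.1.continuous_fderiv one_ne_zero).eq_zero_of_ae_eq_zero_on_balls hRtop
    (Filter.Eventually.of_forall fun j => ?_) x
  have hle : ∫ x in ball (0 : Euc n) (R j), ‖fderiv ℝ u x‖ ^ p x ≤ 0 := by
    refine ge_of_tendsto hlim ?_
    filter_upwards [Filter.eventually_ge_atTop j] with k hk
    refine le_trans ?_ (hestimate k)
    exact setIntegral_mono_set (hint _) (Filter.Eventually.of_forall hnn)
      (ball_subset_ball (hRmono.monotone hk)).eventuallyLE
  have h0 := (integral_eq_zero_iff_of_nonneg hnn (hint (R j))).1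
    (le_antisymm hle (integral_nonneg hnn))
  filter_upwards [(ae_restrict_iff' measurableSet_ball).1 h0, hp.ae_lb] with x hx hpx hxR
  exact norm_eq_zero.1 ((Real.rpow_eq_zero (norm_nonneg _) (by linarith)).1 (hx hxR))

end Liouville

/-- Corollary 3.8 (Phragmén–Lindelöf type): if an `𝒜`-harmonic function `u` satisfies
`|u(x)| ≤ C|x|^α` on annuli `B_{2R_k}∖B_{R_k}` for an unbounded increasing sequence of
radii `R_k > 1` and some `α < p⁻/p⁺ − n/p⁺`, then `u` is constant. -/
theorem phragmen_lindelof {n : ℕ} (p : Euc n → ℝ) (pm pP : ℝ)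
    (hp : IsVarExp p pm pP)
    (𝒜 : Euc n → ℝ → Euc n → Euc n) (am bP : ℝ)
    (h𝒜 : IsNSGrowth p 𝒜 am bP)
    (u : Euc n → ℝ) (hu : IsAHarmonic p 𝒜 u)
    (C : ℝ) (hC : 0 < C)
    (α : ℝ) (hα : α < pm / pP - (n : ℝ) / pP)
    (R : ℕ → ℝ) (hR1 : ∀ k, 1 < R k) (hRmono : StrictMono R)
    (hRtop : Filter.Tendsto R Filter.atTop Filter.atTop)
    (hgrowth : ∀ k, ∀ x ∈ Metric.ball (0 : Euc n) (2 * R k) \ Metric.ball 0 (R k),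
      |u x| ≤ C * ‖x‖ ^ α) :
    ∃ c : ℝ, ∀ x, u x = c := by
  rcases Nat.eq_zero_or_pos n with rfl | hn
  · exact ⟨u 0, fun x => congrArg u (Subsingleton.elim x 0)⟩
  · have : NeZero n := ⟨hn.ne'⟩
    rcases lt_or_ge α 0 with hα0 | hα0
    · exact ⟨0, hu.eq_zero_of_decay hp h𝒜 hα0 hC hR1 hRtop hgrowth⟩
    · refine ⟨u 0, fun x => is_const_of_fderiv_eq_zero (𝕜 := ℝ)
        (hu.1.differentiable one_ne_zero) (fun y => ?_) x 0⟩
      exact hu.fderiv_eq_zero_of_growth hp h𝒜 hC hα0 hα hR1 hRmono hRtop hgrowth y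

end
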